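/- In U = Diff(𝒜), let B = {[x,b] − [y,a] : a, b ∈ U} and let W be the k-linear span of {DⁱEʲ : i, j ≥ 0}. Then B is a k-subspace of U, B ∩ W = 0, and B + W = U; that is, W is a linear complement of the image of the map (a,b) ↦ [x,b] − [y,a] in U. (Consequently H²(S,U) ≅ k[D]⊗k[E].) -/

import Mathlib

/-!
Let `k` be a field of characteristic zero, `t ∈ k`, `t ≠ 0`, and let `U = Diff 𝒜` be the
algebra presented by generators `x, y, D, E` and relations `[y,x] = 0`, `[D,x] = 0`,
`[D,y] = y² + txy`, `[E,x] = x`, `[E,y] = y`, `[E,D] = D`.  Let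
`B = {[x,b] − [y,a] : a, b ∈ U}` and let `W` be the `k`-linear span of `{Dⁱ Eʲ : i,j ≥ 0}`.
Then `B` is a `k`-subspace of `U`, `B ∩ W = 0` and `B + W = U`.
-/

/-- Relations presenting `Diff 𝒜`; the generators are `x = ι 0`, `y = ι 1`, `D = ι 2`,
`E = ι 3`. -/
inductive DiffRel (k : Type) [Field k] (t : k) :
    FreeAlgebra k (Fin 4) → FreeAlgebra k (Fin 4) → Prop
  | yx : DiffRel k t (FreeAlgebra.ι k 1 * FreeAlgebra.ι k 0)
      (FreeAlgebra.ι k 0 * FreeAlgebra.ι k 1)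
  | Dx : DiffRel k t (FreeAlgebra.ι k 2 * FreeAlgebra.ι k 0)
      (FreeAlgebra.ι k 0 * FreeAlgebra.ι k 2)
  | Dy : DiffRel k t (FreeAlgebra.ι k 2 * FreeAlgebra.ι k 1)
      (FreeAlgebra.ι k 1 * FreeAlgebra.ι k 2 +
        (FreeAlgebra.ι k 1 * FreeAlgebra.ι k 1 + t • (FreeAlgebra.ι k 0 * FreeAlgebra.ι k 1)))
  | Ex : DiffRel k t (FreeAlgebra.ι k 3 * FreeAlgebra.ι k 0)
      (FreeAlgebra.ι k 0 * FreeAlgebra.ι k 3 + FreeAlgebra.ι k 0)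
  | Ey : DiffRel k t (FreeAlgebra.ι k 3 * FreeAlgebra.ι k 1)
      (FreeAlgebra.ι k 1 * FreeAlgebra.ι k 3 + FreeAlgebra.ι k 1)
  | ED : DiffRel k t (FreeAlgebra.ι k 3 * FreeAlgebra.ι k 2)
      (FreeAlgebra.ι k 2 * FreeAlgebra.ι k 3 + FreeAlgebra.ι k 2)

/-- The algebra `Diff 𝒜` of differential operators tangent to a central arrangement of
three lines. -/
abbrev DiffA (k : Type) [Field k] (t : k) : Type := RingQuot (DiffRel k t)

variable (k : Type) [Field k] (t : k)

/-- The generator `x` of `Diff 𝒜`. -/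
noncomputable def genX : DiffA k t := RingQuot.mkAlgHom k (DiffRel k t) (FreeAlgebra.ι k 0)

/-- The generator `y` of `Diff 𝒜`. -/
noncomputable def genY : DiffA k t := RingQuot.mkAlgHom k (DiffRel k t) (FreeAlgebra.ι k 1)

/-- The generator `D` of `Diff 𝒜`. -/
noncomputable def genD : DiffA k t := RingQuot.mkAlgHom k (DiffRel k t) (FreeAlgebra.ι k 2)

/-- The generator `E` of `Diff 𝒜`. -/
noncomputable def genE : DiffA k t := RingQuot.mkAlgHom k (DiffRel k t) (FreeAlgebra.ι k 3)

section Helpers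

variable {k}

theorem hp_diff_surj [CharZero k] (p : Polynomial k) :
    ∃ r : Polynomial k, r.comp (Polynomial.X + 1) - r = p := by
  let T : Polynomial k →ₗ[k] Polynomial k :=
      { toFun := fun r => r.comp (Polynomial.X + 1) - r
        map_add' := by intro a b; simp; abel
        map_smul' := by intro a b; simp [smul_sub] }
  have hX : ∀ n : ℕ, (Polynomial.X ^ n : Polynomial k) ∈ LinearMap.range T := by
    intro n
    induction n using Nat.strong_induction_on with
    | _ n ih =>
      have h1 : T (Polynomial.X ^ (n+1)) =
          ((n + 1 : ℕ) : k) • Polynomial.X ^ n +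
          ∑ m ∈ Finset.range n, (((n+1).choose m : ℕ) : k) • (Polynomial.X ^ m : Polynomial k) := by
        change (Polynomial.X ^ (n+1) : Polynomial k).comp (Polynomial.X + 1) - _ = _
        rw [Polynomial.X_pow_comp, add_pow, Finset.sum_range_succ, Finset.sum_range_succ]
        simp [Nat.choose_succ_self_right, Polynomial.smul_eq_C_mul, mul_comm]
        ring
      have h2 : ((n + 1 : ℕ) : k) • (Polynomial.X ^ n : Polynomial k) ∈ LinearMap.range T := by
        have : ((n + 1 : ℕ) : k) • (Polynomial.X ^ n : Polynomial k) = T (Polynomial.X ^ (n+1)) -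
          ∑ m ∈ Finset.range n, (((n+1).choose m : ℕ) : k) • (Polynomial.X ^ m : Polynomial k) := by
          rw [h1]; abel
        rw [this]
        refine Submodule.sub_mem _ ⟨_, rfl⟩ (Submodule.sum_mem _ fun m hm => ?_)
        exact Submodule.smul_mem _ _ (ih m (Finset.mem_range.1 hm))
      have h3 := Submodule.smul_mem _ (((n + 1 : ℕ) : k)⁻¹) h2
      rwa [smul_smul, inv_mul_cancel₀ (by exact_mod_cast Nat.succ_ne_zero n), one_smul] at h3
  have : p ∈ LinearMap.range T := by
    rw [← Polynomial.sum_monomial_eq p, Polynomial.sum]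
    refine Submodule.sum_mem _ fun m hm => ?_
    rw [← Polynomial.C_mul_X_pow_eq_monomial, ← Polynomial.smul_eq_C_mul]
    exact Submodule.smul_mem _ _ (hX m)
  exact this

variable {A : Type} [Ring A] [Algebra k A] {x y D E : A}

theorem hp_shift {z : A} (h : E * z = z * E + z) (p : Polynomial k) :
    Polynomial.aeval E p * z = z * Polynomial.aeval E (p.comp (Polynomial.X + 1)) := by
  have h0 : SemiconjBy z (E + 1) E := by
    unfold SemiconjBy; rw [h]; noncomm_ring
  induction p using Polynomial.induction_on' with
  | add p q hp hq => simp only [map_add, add_mul, hp, hq, Polynomial.add_comp, mul_add]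
  | monomial n c =>
    have := (h0.pow_right n).eq
    simp [← Polynomial.C_mul_X_pow_eq_monomial, ← Polynomial.smul_eq_C_mul, this]

/-- `y^b` past `D`. -/
theorem hp_Dy (hyx : y * x = x * y) (hDy : D * y = y * D + (y * y + t • (x * y))) (b : ℕ) :
    D * y ^ b = y ^ b * D + (b : k) • (y ^ (b+1) + t • (x * y ^ b)) := by
  induction b with
  | zero => simp
  | succ b ih =>
    have hc : Commute (y ^ b) x := Commute.pow_left hyx b
    rw [pow_succ y b, ← mul_assoc, ih, add_mul, mul_assoc (y ^ b) D y, hDy]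
    simp only [mul_add, smul_mul_assoc, mul_smul_comm, add_mul, Nat.cast_add, Nat.cast_one, add_smul,
      one_smul, smul_add, ← mul_assoc, pow_succ, hc.eq]
    abel

theorem hp_Dxy (hyx : y * x = x * y) (hDx : D * x = x * D)
    (hDy : D * y = y * D + (y * y + t • (x * y))) (a b : ℕ) :
    D * (x ^ a * y ^ b) = x ^ a * y ^ b * D +
      (b : k) • (x ^ a * y ^ (b+1) + t • (x ^ (a+1) * y ^ b)) := by
  have hc : Commute D (x ^ a) := Commute.pow_right hDx a
  rw [← mul_assoc, hc.eq, mul_assoc, hp_Dy t hyx hDy]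
  simp only [mul_add, mul_smul_comm, smul_add, ← mul_assoc, pow_succ]

/-- the space spanned by `x^a y^b D^l`, `l < i`. -/
def hpL (k : Type) [Field k] {A : Type} [Ring A] [Algebra k A] (x y D : A) (i : ℕ) :
    Submodule k A :=
  Submodule.span k {w | ∃ a b l : ℕ, l < i ∧ w = x ^ a * y ^ b * D ^ l}

theorem hpL_mem {i a b l : ℕ} (h : l < i) : x ^ a * y ^ b * D ^ l ∈ hpL k x y D i :=
  Submodule.subset_span ⟨a, b, l, h, rfl⟩

theorem hp_L_step (hyx : y * x = x * y) (hDx : D * x = x * D)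
    (hDy : D * y = y * D + (y * y + t • (x * y))) (i : ℕ) (w : A) (hw : w ∈ hpL k x y D i) :
    (D + (y + t • x)) * w ∈ hpL k x y D (i+1) := by
  induction hw using Submodule.span_induction with
  | zero => simp
  | add u v _ _ hu hv => rw [mul_add]; exact add_mem hu hv
  | smul c u _ hu => rw [mul_smul_comm]; exact Submodule.smul_mem _ _ hu
  | mem w hw =>
    obtain ⟨a, b, l, hl, rfl⟩ := hw
    have hc : Commute y (x ^ a) := Commute.pow_right hyx a
    have e1 : y * (x ^ a * y ^ b * D ^ l) = x ^ a * y ^ (b+1) * D ^ l := by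
      rw [← mul_assoc, ← mul_assoc, hc.eq, mul_assoc (x ^ a), ← pow_succ']
    have e2 : x * (x ^ a * y ^ b * D ^ l) = x ^ (a+1) * y ^ b * D ^ l := by
      rw [← mul_assoc, ← mul_assoc, ← pow_succ']
    have e3 : D * (x ^ a * y ^ b * D ^ l) = x ^ a * y ^ b * D ^ (l+1) + (b : k) •
        (x ^ a * y ^ (b+1) * D ^ l + t • (x ^ (a+1) * y ^ b * D ^ l)) := by
      rw [← mul_assoc, hp_Dxy t hyx hDx hDy, add_mul, mul_assoc, ← pow_succ']
      simp only [smul_mul_assoc, add_mul]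
    rw [add_mul, add_mul, smul_mul_assoc, e1, e2, e3]
    have hl' : l < i + 1 := by omega
    exact add_mem (add_mem (hpL_mem (by omega)) (Submodule.smul_mem _ _ (add_mem (hpL_mem hl')
      (Submodule.smul_mem _ _ (hpL_mem hl'))))) (add_mem (hpL_mem hl')
      (Submodule.smul_mem _ _ (hpL_mem hl')))

theorem hp_L_pow (hyx : y * x = x * y) (hDx : D * x = x * D)
    (hDy : D * y = y * D + (y * y + t • (x * y))) (i : ℕ) :
    (D + (y + t • x)) ^ i - D ^ i ∈ hpL k x y D i := by
  induction i with
  | zero => simp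
  | succ i ih =>
    have : (D + (y + t • x)) ^ (i+1) - D ^ (i+1) =
        (D + (y + t • x)) * ((D + (y + t • x)) ^ i - D ^ i) +
        (x ^ 0 * y ^ 1 * D ^ i + t • (x ^ 1 * y ^ 0 * D ^ i)) := by
      rw [pow_succ', pow_succ' D]
      simp only [mul_sub, add_mul, pow_zero, pow_one, one_mul, mul_one, smul_mul_assoc]
      abel
    rw [this]
    exact add_mem (hp_L_step t hyx hDx hDy i _ ih) (add_mem (hpL_mem (by omega))
      (Submodule.smul_mem _ _ (hpL_mem (by omega))))

/-- the inner derivation `[z, -]`. -/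
def hpAd (k : Type) [Field k] {A : Type} [Ring A] [Algebra k A] (z : A) : A →ₗ[k] A :=
  LinearMap.mulLeft k z - LinearMap.mulRight k z

theorem hpAd_apply (z u : A) : hpAd k z u = z * u - u * z := rfl

theorem hp_aux1 (a b : A) : hpAd k x b + hpAd k y a =
    (x * b - b * x) - (y * ((-1 : k) • a) - ((-1 : k) • a) * y) := by
  simp only [hpAd_apply, neg_smul, one_smul, mul_neg, neg_mul]
  abel

theorem hp_aux2 (a b : A) : hpAd k x b + hpAd k y ((-1 : k) • a) =
    (x * b - b * x) - (y * a - a * y) := by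
  simp only [hpAd_apply, neg_smul, one_smul, mul_neg, neg_mul]
  abel

theorem hp_x_mem [CharZero k] (hyx : y * x = x * y) (hDx : D * x = x * D)
    (hEx : E * x = x * E + x) (a b i j : ℕ) :
    x * (x ^ a * y ^ b * D ^ i * E ^ j) ∈ LinearMap.range (hpAd k x) := by
  obtain ⟨r, hr⟩ := hp_diff_surj (k := k) (Polynomial.X ^ j)
  refine ⟨- (x ^ a * y ^ b * D ^ i * Polynomial.aeval E r), ?_⟩
  have hc : Commute (x ^ a * y ^ b * D ^ i) x :=
    ((Commute.pow_left (Commute.refl x) a).mul_left (Commute.pow_left hyx b)).mul_left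
      (Commute.pow_left hDx i)
  have hj : E ^ j = Polynomial.aeval E (Polynomial.X ^ j : Polynomial k) := by simp
  rw [hpAd_apply, hj, ← hr, map_sub]
  generalize x ^ a * y ^ b * D ^ i = w at hc ⊢
  rw [neg_mul, mul_assoc, hp_shift hEx, ← mul_assoc w, hc.eq]
  noncomm_ring

theorem hp_y_mem [CharZero k] (hyx : y * x = x * y) (hDx : D * x = x * D)
    (hDy : D * y = y * D + (y * y + t • (x * y)))
    (hEy : E * y = y * E + y) (i : ℕ) : ∀ (a b : ℕ) (p : Polynomial k),
    y * (x ^ a * y ^ b * D ^ i * Polynomial.aeval E p) ∈ LinearMap.range (hpAd k y) := by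
  induction i using Nat.strong_induction_on with
  | _ i ih =>
    intro a b p
    obtain ⟨r, hr⟩ := hp_diff_surj p
    have hc : Commute (x ^ a * y ^ b) y :=
      (Commute.pow_left (Commute.symm hyx) a).mul_left (Commute.pow_left (Commute.refl y) b)
    have hs : SemiconjBy y (D + (y + t • x)) D := by
      unfold SemiconjBy; rw [hDy]; simp only [mul_add, mul_smul_comm, hyx]
    have hD := (hs.pow_right i).eq
    have key : y * (x ^ a * y ^ b * D ^ i * Polynomial.aeval E p) =
        hpAd k y (- (x ^ a * y ^ b * D ^ i * Polynomial.aeval E r)) -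
        y * (x ^ a * y ^ b * ((D + (y + t • x)) ^ i - D ^ i) *
          Polynomial.aeval E (r.comp (Polynomial.X + 1))) := by
      rw [hpAd_apply, ← hr, map_sub]
      have e : x ^ a * y ^ b * D ^ i * Polynomial.aeval E r * y =
          y * (x ^ a * y ^ b * (D + (y + t • x)) ^ i *
            Polynomial.aeval E (r.comp (Polynomial.X + 1))) := by
        rw [mul_assoc _ _ y, hp_shift hEy, ← mul_assoc _ y, mul_assoc _ _ y, ← hD,
          ← mul_assoc _ y, hc.eq]
        simp only [mul_assoc]
      rw [neg_mul, e]
      noncomm_ring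
    rw [key]
    refine sub_mem ⟨_, rfl⟩ ?_
    generalize r.comp (Polynomial.X + 1) = q
    have hL := hp_L_pow t hyx hDx hDy i
    generalize (D + (y + t • x)) ^ i - D ^ i = w at hL
    induction hL using Submodule.span_induction with
    | zero => simp
    | add u v _ _ hu hv => rw [mul_add, add_mul, mul_add]; exact add_mem hu hv
    | smul c u _ hu =>
      rw [mul_smul_comm, smul_mul_assoc, mul_smul_comm]; exact Submodule.smul_mem _ _ hu
    | mem w hw =>
      obtain ⟨a', b', l, hl, rfl⟩ := hw
      have hc' : Commute (y ^ b) (x ^ a') := Commute.pow_pow hyx b a'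
      have : x ^ a * y ^ b * (x ^ a' * y ^ b' * D ^ l) =
          x ^ (a + a') * y ^ (b + b') * D ^ l := by
        rw [pow_add, pow_add, mul_assoc (x ^ a) (y ^ b), ← mul_assoc (y ^ b),
          ← mul_assoc (y ^ b) (x ^ a'), hc'.eq]
        simp only [mul_assoc]
      rw [this]
      exact ih l hl _ _ _

/-- the span of the ordered monomials. -/
def hpV (k : Type) [Field k] {A : Type} [Ring A] [Algebra k A] (x y D E : A) :
    Submodule k A :=
  Submodule.span k {w | ∃ a b i j : ℕ, w = x ^ a * y ^ b * D ^ i * E ^ j}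

theorem hpV_mem {a b i j : ℕ} : x ^ a * y ^ b * D ^ i * E ^ j ∈ hpV k x y D E :=
  Submodule.subset_span ⟨a, b, i, j, rfl⟩

theorem hpV_closed {z : A} (h : ∀ a b i j : ℕ, z * (x ^ a * y ^ b * D ^ i * E ^ j) ∈ hpV k x y D E)
    (w : A) (hw : w ∈ hpV k x y D E) : z * w ∈ hpV k x y D E := by
  induction hw using Submodule.span_induction with
  | zero => simp
  | add u v _ _ hu hv => rw [mul_add]; exact add_mem hu hv
  | smul c u _ hu => rw [mul_smul_comm]; exact Submodule.smul_mem _ _ hu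
  | mem w hw =>
    obtain ⟨a, b, i, j, rfl⟩ := hw
    exact h a b i j

theorem hpV_x (w : A) (hw : w ∈ hpV k x y D E) : x * w ∈ hpV k x y D E := by
  refine hpV_closed (fun a b i j => ?_) w hw
  have : x * (x ^ a * y ^ b * D ^ i * E ^ j) = x ^ (a+1) * y ^ b * D ^ i * E ^ j := by
    rw [pow_succ']; simp only [mul_assoc]
  rw [this]; exact hpV_mem

theorem hp_ymul (hyx : y * x = x * y) (a b i j : ℕ) :
    y * (x ^ a * y ^ b * D ^ i * E ^ j) = x ^ a * y ^ (b+1) * D ^ i * E ^ j := by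
  have hc : Commute y (x ^ a) := Commute.pow_right hyx a
  rw [pow_succ' y]; simp only [← mul_assoc]; rw [hc.eq]

theorem hpV_y (hyx : y * x = x * y) (w : A) (hw : w ∈ hpV k x y D E) :
    y * w ∈ hpV k x y D E := by
  refine hpV_closed (fun a b i j => ?_) w hw
  rw [hp_ymul hyx]; exact hpV_mem

theorem hpV_D (hyx : y * x = x * y) (hDx : D * x = x * D)
    (hDy : D * y = y * D + (y * y + t • (x * y))) (w : A) (hw : w ∈ hpV k x y D E) :
    D * w ∈ hpV k x y D E := by
  refine hpV_closed (fun a b i j => ?_) w hw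
  have : D * (x ^ a * y ^ b * D ^ i * E ^ j) = x ^ a * y ^ b * D ^ (i+1) * E ^ j + (b : k) •
      (x ^ a * y ^ (b+1) * D ^ i * E ^ j + t • (x ^ (a+1) * y ^ b * D ^ i * E ^ j)) := by
    rw [← mul_assoc, ← mul_assoc, hp_Dxy t hyx hDx hDy, pow_succ' D]
    simp only [smul_mul_assoc, add_mul, mul_assoc]
  rw [this]
  exact add_mem hpV_mem (Submodule.smul_mem _ _ (add_mem hpV_mem (Submodule.smul_mem _ _ hpV_mem)))

theorem hp_Epow {z : A} (h : E * z = z * E + z) (n : ℕ) :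
    E * z ^ n = z ^ n * (E + (n : A)) := by
  induction n with
  | zero => simp
  | succ n ih =>
    have hc : Commute (n : A) z := Nat.cast_commute n z
    rw [pow_succ, ← mul_assoc, ih, mul_assoc, add_mul, h, hc.eq]
    push_cast
    noncomm_ring

theorem hpV_E (hEx : E * x = x * E + x) (hEy : E * y = y * E + y) (hED : E * D = D * E + D)
    (w : A) (hw : w ∈ hpV k x y D E) :
    E * w ∈ hpV k x y D E := by
  refine hpV_closed (fun a b i j => ?_) w hw
  have h2 : ∀ (n : ℕ) (u : A), (n : A) * u = (n : k) • u := by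
    intro n u; rw [Algebra.smul_def, map_natCast]
  have h1 : ∀ {z : A} (_ : E * z = z * E + z) (n : ℕ) (u : A),
      E * (z ^ n * u) = z ^ n * (E * u) + (n : k) • (z ^ n * u) := by
    intro z hz n u
    rw [← mul_assoc, hp_Epow hz, mul_assoc, add_mul, mul_add, h2, mul_smul_comm]
  have : E * (x ^ a * y ^ b * D ^ i * E ^ j) = x ^ a * y ^ b * D ^ i * E ^ (j+1) +
      ((a : k) + b + i) • (x ^ a * y ^ b * D ^ i * E ^ j) := by
    simp only [mul_assoc, h1 hEx, h1 hEy, h1 hED, mul_add, mul_smul_comm, add_smul, pow_succ']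
    abel
  rw [this]
  exact add_mem hpV_mem (Submodule.smul_mem _ _ hpV_mem)

theorem hp_rel {u v : FreeAlgebra k (Fin 4)} (h : DiffRel k t u v) :
    RingQuot.mkAlgHom k (DiffRel k t) u = RingQuot.mkAlgHom k (DiffRel k t) v :=
  RingQuot.mkAlgHom_rel k h

theorem hp_yx : genY k t * genX k t = genX k t * genY k t := by
  simpa [genX, genY, genD, genE] using hp_rel t (DiffRel.yx (k := k) (t := t))
theorem hp_gDx : genD k t * genX k t = genX k t * genD k t := by
  simpa [genX, genY, genD, genE] using hp_rel t (DiffRel.Dx (k := k) (t := t))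
theorem hp_gDy : genD k t * genY k t = genY k t * genD k t +
    (genY k t * genY k t + t • (genX k t * genY k t)) := by
  simpa [genX, genY, genD, genE] using hp_rel t (DiffRel.Dy (k := k) (t := t))
theorem hp_gEx : genE k t * genX k t = genX k t * genE k t + genX k t := by
  simpa [genX, genY, genD, genE] using hp_rel t (DiffRel.Ex (k := k) (t := t))
theorem hp_gEy : genE k t * genY k t = genY k t * genE k t + genY k t := by
  simpa [genX, genY, genD, genE] using hp_rel t (DiffRel.Ey (k := k) (t := t))
theorem hp_gED : genE k t * genD k t = genD k t * genE k t + genD k t := by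
  simpa [genX, genY, genD, genE] using hp_rel t (DiffRel.ED (k := k) (t := t))

theorem hpV_top : hpV k (genX k t) (genY k t) (genD k t) (genE k t) = ⊤ := by
  rw [eq_top_iff]
  rintro u -
  obtain ⟨u, rfl⟩ := RingQuot.mkAlgHom_surjective k (DiffRel k t) u
  have key : ∀ w ∈ hpV k (genX k t) (genY k t) (genD k t) (genE k t),
      RingQuot.mkAlgHom k (DiffRel k t) u * w ∈
        hpV k (genX k t) (genY k t) (genD k t) (genE k t) := by
    induction u using FreeAlgebra.induction with
    | grade0 c =>
      intro w hw
      rw [AlgHom.commutes, ← Algebra.smul_def]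
      exact Submodule.smul_mem _ _ hw
    | grade1 n =>
      intro w hw
      fin_cases n
      · exact hpV_x w hw
      · exact hpV_y (hp_yx t) w hw
      · exact hpV_D t (hp_yx t) (hp_gDx t) (hp_gDy t) w hw
      · exact hpV_E (hp_gEx t) (hp_gEy t) (hp_gED t) w hw
    | mul a b ha hb =>
      intro w hw
      rw [map_mul, mul_assoc]
      exact ha _ (hb _ hw)
    | add a b ha hb =>
      intro w hw
      rw [map_add, add_mul]
      exact add_mem (ha _ hw) (hb _ hw)
  have h0 : (genX k t) ^ 0 * (genY k t) ^ 0 * (genD k t) ^ 0 * (genE k t) ^ 0 ∈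
      hpV k (genX k t) (genY k t) (genD k t) (genE k t) := hpV_mem
  have h1 := key _ h0
  simpa using h1

/-- `X d/dX` as an operator on polynomials. -/
noncomputable def hpEuler (k : Type) [Field k] : Module.End k (Polynomial k) :=
  LinearMap.mulLeft k (Polynomial.X : Polynomial k) * Polynomial.derivative

/-- multiplication by `X`. -/
noncomputable def hpMulX (k : Type) [Field k] : Module.End k (Polynomial k) :=
  LinearMap.mulLeft k (Polynomial.X : Polynomial k)

theorem hp_comm : hpEuler k * hpMulX k = hpMulX k * hpEuler k + hpMulX k := by
  refine LinearMap.ext fun p => ?_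
  simp [hpEuler, hpMulX]
  ring

/-- the representation. -/
noncomputable def hpRep (k : Type) [Field k] (t : k) : DiffA k t →ₐ[k] Module.End k (Polynomial k) :=
  RingQuot.liftAlgHom k ⟨FreeAlgebra.lift k ![0, 0, hpMulX k, hpEuler k], by
    intro u v h
    cases h <;> simp [hp_comm]⟩

theorem hpRep_x : hpRep k t (genX k t) = 0 := by
  simp [hpRep, genX]
theorem hpRep_y : hpRep k t (genY k t) = 0 := by
  simp [hpRep, genY]
theorem hpRep_D : hpRep k t (genD k t) = hpMulX k := by
  simp [hpRep, genD]
theorem hpRep_E : hpRep k t (genE k t) = hpEuler k := by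
  simp [hpRep, genE]

theorem hp_act (i j n : ℕ) : (hpMulX k ^ i * hpEuler k ^ j) (Polynomial.X ^ n) =
    ((n : k) ^ j) • Polynomial.X ^ (n + i) := by
  have h1 : ∀ j : ℕ, (hpEuler k ^ j) (Polynomial.X ^ n) = ((n : k) ^ j) • Polynomial.X ^ n := by
    intro j
    induction j with
    | zero => simp
    | succ j ih =>
      rw [pow_succ', Module.End.mul_apply, ih, map_smul, pow_succ, mul_smul]
      congr 1
      cases n with
      | zero => simp [hpEuler]
      | succ n =>
        simp [hpEuler, Polynomial.smul_eq_C_mul]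
        ring
  have h2 : ∀ (i : ℕ) (p : Polynomial k), (hpMulX k ^ i) p = Polynomial.X ^ i * p := by
    intro i
    induction i with
    | zero => simp
    | succ i ih =>
      intro p
      rw [pow_succ', Module.End.mul_apply, ih, pow_succ']
      simp [hpMulX, mul_assoc]
  rw [Module.End.mul_apply, h1, map_smul, h2, ← pow_add, add_comm]

theorem hp_indep [CharZero k] (c : ℕ × ℕ →₀ k)
    (h : (c.sum fun p a => a • (hpMulX k ^ p.1 * hpEuler k ^ p.2)) = 0) : c = 0 := by
  have hn : ∀ n i : ℕ, (c.sum fun p a => if p.1 = i then a * (n : k) ^ p.2 else 0) = 0 := by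
    intro n i
    have h1 := congrArg (fun f : Module.End k (Polynomial k) =>
      (f (Polynomial.X ^ n)).coeff (n + i)) h
    simp only [Finsupp.sum, LinearMap.sum_apply, LinearMap.smul_apply, hp_act,
      Polynomial.finsetSum_coeff, Polynomial.coeff_smul, Polynomial.coeff_X_pow,
      LinearMap.zero_apply, Polynomial.coeff_zero, smul_eq_mul] at h1
    rw [Finsupp.sum]
    refine Eq.trans ?_ h1
    refine Finset.sum_congr rfl fun p _ => ?_
    by_cases hp : p.1 = i
    · simp [hp]
    · have : ¬ (n + i = n + p.1) := by omega
      rw [if_neg hp, if_neg this, mul_zero, mul_zero]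
  ext ⟨i, j⟩
  let q : Polynomial k := c.sum fun p a => if p.1 = i then Polynomial.monomial p.2 a else 0
  have hq : q = 0 := by
    refine Polynomial.eq_zero_of_infinite_isRoot q ?_
    refine Set.Infinite.mono ?_ (Set.infinite_range_of_injective (Nat.cast_injective (R := k)))
    rintro _ ⟨n, rfl⟩
    change q.eval (n : k) = 0
    rw [← hn n i]
    simp only [q, Finsupp.sum, Polynomial.eval_finsetSum]
    refine Finset.sum_congr rfl fun p _ => ?_
    split_ifs <;> simp
  have h2 : q.coeff j = c (i, j) := by
    simp only [q, Finsupp.sum, Polynomial.finsetSum_coeff]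
    rw [Finset.sum_eq_single (i, j)]
    · simp
    · rintro ⟨a, b⟩ _ hne
      by_cases ha : a = i
      · have hb : b ≠ j := by rintro rfl; exact hne (by rw [ha])
        simp [ha, Polynomial.coeff_monomial, hb]
      · simp [ha]
    · intro hc
      simp [Finsupp.notMem_support_iff.1 hc]
  rw [← h2, hq]; simp

end Helpers

/-- The set `B = {[x,b] − [y,a] : a, b ∈ U}` is a `k`-subspace of `U = Diff 𝒜`, the span `W`
of `{Dⁱ Eʲ : i, j ≥ 0}` intersects it trivially, and `B + W = U`; i.e. `W` is a linear
complement of `B` in `U`.  (Consequently `H²(S,U) ≅ k[D] ⊗ k[E]`.) -/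
theorem commutator_image_compl_span_DE
    [CharZero k] (ht : t ≠ 0) :
    ∃ B : Submodule k (DiffA k t),
      (B : Set (DiffA k t)) =
        {w : DiffA k t | ∃ a b : DiffA k t,
          w = (genX k t * b - b * genX k t) - (genY k t * a - a * genY k t)} ∧
      B ⊓ Submodule.span k
          {w : DiffA k t | ∃ i j : ℕ, w = genD k t ^ i * genE k t ^ j} = ⊥ ∧
      B ⊔ Submodule.span k
          {w : DiffA k t | ∃ i j : ℕ, w = genD k t ^ i * genE k t ^ j} = ⊤ := by
  refine ⟨LinearMap.range (hpAd k (genX k t)) ⊔ LinearMap.range (hpAd k (genY k t)), ?_, ?_, ?_⟩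
  · ext w
    simp only [SetLike.mem_coe, Submodule.mem_sup, LinearMap.mem_range, Set.mem_ofPred_eq]
    constructor
    · rintro ⟨_, ⟨b, rfl⟩, _, ⟨a, rfl⟩, rfl⟩
      refine ⟨(-1 : k) • a, b, ?_⟩
      exact hp_aux1 a b
    · rintro ⟨a, b, rfl⟩
      refine ⟨_, ⟨b, rfl⟩, _, ⟨(-1 : k) • a, rfl⟩, ?_⟩
      exact hp_aux2 a b
  · rw [eq_bot_iff]
    rintro w ⟨hB, hW⟩
    have hset : {w : DiffA k t | ∃ i j : ℕ, w = genD k t ^ i * genE k t ^ j} =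
        Set.range (fun p : ℕ × ℕ => genD k t ^ p.1 * genE k t ^ p.2) := by
      ext w
      simp [eq_comm]
    have hz : hpRep k t w = 0 := by
      obtain ⟨_, ⟨b, rfl⟩, _, ⟨a, rfl⟩, rfl⟩ := Submodule.mem_sup.1 hB
      simp [hpAd_apply, hpRep_x, hpRep_y]
    rw [SetLike.mem_coe, hset, Finsupp.mem_span_range_iff_exists_finsupp] at hW
    obtain ⟨c, rfl⟩ := hW
    have : c = 0 := by
      apply hp_indep
      rw [← hz]
      simp [Finsupp.sum, hpRep_D, hpRep_E]
    simp [this]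
  · rw [eq_top_iff, ← hpV_top t, hpV, Submodule.span_le]
    rintro _ ⟨a, b, i, j, rfl⟩
    rcases a with _ | a
    · rcases b with _ | b
      · refine Submodule.mem_sup_right (Submodule.subset_span ⟨i, j, ?_⟩)
        simp
      · refine Submodule.mem_sup_left (Submodule.mem_sup_right ?_)
        rw [← hp_ymul (hp_yx t)]
        have := hp_y_mem t (hp_yx t) (hp_gDx t) (hp_gDy t) (hp_gEy t) i 0 b (Polynomial.X ^ j)
        rwa [Polynomial.aeval_X_pow] at this
    · refine Submodule.mem_sup_left (Submodule.mem_sup_left ?_)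
      have := hp_x_mem (k := k) (hp_yx t) (hp_gDx t) (hp_gEx t) a b i j
      rw [pow_succ']
      simpa only [mul_assoc] using this
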